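/- Reduction to deterministic player-II actions (Lemma 6 of the paper): In a PGS with partition pair (Σ, ⪯), if for every action b ∈ Act_II there exists a mixed action π'' ∈ Π_II such that δ̂(s, ⟨π, π''⟩)_Σ ⪯̂ δ̂(t, ⟨π', δ_b⟩)_Σ, then step(s, π)_Σ (⪯̂)_{Sm} step(t, π')_Σ. -/

import Mathlib

namespace PAGame

open Finset

/-- A discrete probability distribution on a finite set `S`:
a function into `[0,1]` summing to `1`. -/
def ProbDist {S : Type*} [Fintype S] (Δ : S → ℝ) : Prop :=
  (∀ s, 0 ≤ Δ s ∧ Δ s ≤ 1) ∧ ∑ s, Δ s = 1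

/-- The Dirac (point) distribution on `s`. -/
noncomputable def diracD {S : Type*} (s : S) : S → ℝ :=
  fun t => by classical exact if t = s then 1 else 0

/-- Lifting of a relation `R ⊆ S × T` to distributions, via weight functions. -/
def LiftRel {S T : Type*} [Fintype S] [Fintype T] (R : S → T → Prop)
    (Δ : S → ℝ) (Θ : T → ℝ) : Prop :=
  ∃ w : S → T → ℝ, (∀ s t, 0 ≤ w s t ∧ w s t ≤ 1) ∧
    (∀ s, ∑ t, w s t = Δ s) ∧ (∀ t, ∑ s, w s t = Θ t) ∧
    ∀ s t, 0 < w s t → R s t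

/-- A partition of `S` into (nonempty) blocks. -/
def IsPartition {S : Type*} (C : Finset (Finset S)) : Prop :=
  (∀ s : S, ∃! B, B ∈ C ∧ s ∈ B) ∧ ∀ B ∈ C, B.Nonempty

/-- `r` is a partial order on the blocks of the partition `C`. -/
def IsPartialOrderOn {S : Type*} (C : Finset (Finset S))
    (r : Finset S → Finset S → Prop) : Prop :=
  (∀ P Q, r P Q → P ∈ C ∧ Q ∈ C) ∧ (∀ P ∈ C, r P P) ∧
  (∀ P Q, r P Q → r Q P → P = Q) ∧ ∀ P Q R', r P Q → r Q R' → r P R'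

/-- A distribution on `S` mapped onto blocks: `Δ_Σ(B) = Δ(B)`. -/
def distOn {S : Type*} (Δ : S → ℝ) : Finset S → ℝ := fun B => ∑ x ∈ B, Δ x

/-- Lifting of a relation on blocks of the partition `C` to distributions over blocks. -/
def LiftRelP {S : Type*} (C : Finset (Finset S)) (r : Finset S → Finset S → Prop)
    (D E : Finset S → ℝ) : Prop :=
  ∃ w : Finset S → Finset S → ℝ, (∀ P Q, 0 ≤ w P Q) ∧
    (∀ P ∈ C, ∑ Q ∈ C, w P Q = D P) ∧ (∀ Q ∈ C, ∑ P ∈ C, w P Q = E Q) ∧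
    ∀ P Q, 0 < w P Q → r P Q

/-- Smyth order on sets, induced by a relation `lift`. -/
def Smyth {α : Type*} (lift : α → α → Prop) (A B : Set α) : Prop :=
  ∀ Θ ∈ B, ∃ Δ ∈ A, lift Δ Θ

/-- The transition function lifted to mixed actions:
`δ̂(s,⟨π₁,π₂⟩)(t) = ∑ π₁(a₁)·π₂(a₂)·δ(s,⟨a₁,a₂⟩)(t)`. -/
def stepD {S A₁ A₂ : Type*} [Fintype A₁] [Fintype A₂]
    (δ : S → A₁ → A₂ → S → ℝ) (s : S) (π₁ : A₁ → ℝ) (π₂ : A₂ → ℝ) : S → ℝ :=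
  fun t => ∑ a₁, ∑ a₂, π₁ a₁ * π₂ a₂ * δ s a₁ a₂ t

/-- `step(s,π)_Σ`: the set of next-state distributions (mapped onto blocks)
possible when player I plays the mixed action `π₁` in `s`. -/
def stepSet {S A₁ A₂ : Type*} [Fintype S] [Fintype A₁] [Fintype A₂]
    (δ : S → A₁ → A₂ → S → ℝ) (s : S) (π₁ : A₁ → ℝ) : Set (Finset S → ℝ) :=
  { D | ∃ π₂ : A₂ → ℝ, ProbDist π₂ ∧ D = distOn (stepD δ s π₁ π₂) }

/-- `t` simulates `s` with respect to player I's choice on the partition pair `(C,r)`. -/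
def SimChoice {S A₁ A₂ : Type*} [Fintype S] [Fintype A₁] [Fintype A₂]
    (C : Finset (Finset S)) (r : Finset S → Finset S → Prop)
    (δ : S → A₁ → A₂ → S → ℝ) (s t : S) : Prop :=
  ∀ π : A₁ → ℝ, ProbDist π → ∃ π' : A₁ → ℝ, ProbDist π' ∧
    Smyth (LiftRelP C r) (stepSet δ s π) (stepSet δ t π')

/-- The partition pair `(C,r)` is stable with respect to player I's choice. -/
def StableChoice {S A₁ A₂ : Type*} [Fintype S] [Fintype A₁] [Fintype A₂]
    (C : Finset (Finset S)) (r : Finset S → Finset S → Prop)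
    (δ : S → A₁ → A₂ → S → ℝ) : Prop :=
  ∀ π : A₁ → ℝ, ProbDist π → ∀ P Q, r P Q → ∀ s ∈ P,
    ∃ π' : A₁ → ℝ, ProbDist π' ∧
      ∀ t ∈ Q, Smyth (LiftRelP C r) (stepSet δ s π) (stepSet δ t π')

/-- Probabilistic alternating I-simulation. -/
def IsPASim {S AP A₁ A₂ : Type*} [Fintype S] [Fintype A₁] [Fintype A₂]
    (L : S → AP) (δ : S → A₁ → A₂ → S → ℝ) (R : S → S → Prop) : Prop :=
  ∀ s t, R s t → L s = L t ∧
    ∀ π₁ : A₁ → ℝ, ProbDist π₁ → ∃ π₁' : A₁ → ℝ, ProbDist π₁' ∧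
      ∀ π₂' : A₂ → ℝ, ProbDist π₂' → ∃ π₂ : A₂ → ℝ, ProbDist π₂ ∧
        LiftRel R (stepD δ s π₁ π₂) (stepD δ t π₁' π₂')

/-- The order on partition pairs: `(C₁,r₁) ≤ (C₂,r₂)` iff `C₁` is finer than `C₂`
and `r₁` is contained in the relation on `C₁` induced by `r₂`. -/
def PPLe {S : Type*} (C₁ : Finset (Finset S)) (r₁ : Finset S → Finset S → Prop)
    (C₂ : Finset (Finset S)) (r₂ : Finset S → Finset S → Prop) : Prop :=
  (∀ P ∈ C₁, ∃ Q ∈ C₂, P ⊆ Q) ∧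
  ∀ P Q, r₁ P Q → ∃ P' Q', P' ∈ C₂ ∧ Q' ∈ C₂ ∧ P ⊆ P' ∧ Q ⊆ Q' ∧ r₂ P' Q'

/-- `(C₁,r₁)` is stable on `(C₂,r₂)`. -/
def StableOn {S A₁ A₂ : Type*} [Fintype S] [Fintype A₁] [Fintype A₂]
    (C₁ : Finset (Finset S)) (r₁ : Finset S → Finset S → Prop)
    (C₂ : Finset (Finset S)) (r₂ : Finset S → Finset S → Prop)
    (δ : S → A₁ → A₂ → S → ℝ) : Prop :=
  ∀ P Q, r₁ P Q → ∀ s ∈ P, ∀ t ∈ Q, SimChoice C₂ r₂ δ s t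

/-- `Δ(↑B)` : the mass of the up-closure of block `B` w.r.t. the order `r`. -/
noncomputable def upMass {S : Type*} (C : Finset (Finset S))
    (r : Finset S → Finset S → Prop) (Δ : S → ℝ) (B : Finset S) : ℝ := by
  classical exact ∑ B' ∈ C, if r B B' then distOn Δ B' else 0

/-- `Δ(↑s)` for a partial order on `S`. -/
noncomputable def upClMass {S : Type*} [Fintype S] [PartialOrder S]
    (Δ : S → ℝ) (s : S) : ℝ := by
  classical exact ∑ t ∈ Finset.univ.filter (fun t => s ≤ t), Δ t

/-- The labelling partition `Σ₀`: states grouped by equal labels. -/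
def labelPartition {S AP : Type*} [Fintype S] [DecidableEq S] [DecidableEq AP]
    (L : S → AP) : Finset (Finset S) :=
  Finset.univ.image (fun s => Finset.univ.filter (fun t => L t = L s))

/-- `(C,r) ≤ (Σ₀, Id)`: blocks have constant labels and related blocks agree on labels. -/
def BelowLabel {S AP : Type*} (L : S → AP) (C : Finset (Finset S))
    (r : Finset S → Finset S → Prop) : Prop :=
  (∀ P ∈ C, ∀ s ∈ P, ∀ t ∈ P, L s = L t) ∧
  ∀ P Q, r P Q → ∀ s ∈ P, ∀ t ∈ Q, L s = L t

/-- `(C',r')` is the largest partition pair below `(C,r)` that is stable on `(C,r)`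
(the refinement operator ρ). -/
def IsRho {S A₁ A₂ : Type*} [Fintype S] [Fintype A₁] [Fintype A₂]
    (δ : S → A₁ → A₂ → S → ℝ)
    (C : Finset (Finset S)) (r : Finset S → Finset S → Prop)
    (C' : Finset (Finset S)) (r' : Finset S → Finset S → Prop) : Prop :=
  (IsPartition C' ∧ IsPartialOrderOn C' r' ∧ PPLe C' r' C r ∧ StableOn C' r' C r δ) ∧
  ∀ C'' r'', IsPartition C'' → IsPartialOrderOn C'' r'' → PPLe C'' r'' C r →
    StableOn C'' r'' C r δ → PPLe C'' r'' C' r'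

end PAGame

namespace PAGame

/-- Linearity of the lifted step in the mixed action of player II. -/
theorem distOn_stepD_mix {S A₁ A₂ B : Type*} [Fintype A₁] [Fintype A₂] [Fintype B]
    (δ : S → A₁ → A₂ → S → ℝ) (s : S) (π : A₁ → ℝ) (p : B → ℝ) (q : B → A₂ → ℝ)
    (P : Finset S) :
    distOn (stepD δ s π (fun a => ∑ b, p b * q b a)) P
      = ∑ b, p b * distOn (stepD δ s π (q b)) P := by
  simp only [distOn, stepD, Finset.mul_sum, Finset.sum_mul]
  rw [Finset.sum_comm]
  conv_rhs => rw [Finset.sum_comm]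
  rw [Finset.sum_comm]
  refine Finset.sum_congr rfl fun x _ => ?_
  conv_rhs => rw [Finset.sum_comm]
  refine Finset.sum_congr rfl fun a _ => ?_
  conv_rhs => rw [Finset.sum_comm]
  refine Finset.sum_congr rfl fun c _ => Finset.sum_congr rfl fun b _ => ?_
  ring

/-- Lemma 6: to establish the Smyth order it suffices to match
the deterministic player-II actions on the right-hand side. -/
theorem stmt16 {S A₁ A₂ : Type*} [Fintype S] [Fintype A₁] [Fintype A₂]
    (δ : S → A₁ → A₂ → S → ℝ) (hδ : ∀ s a b, ProbDist (δ s a b))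
    (C : Finset (Finset S)) (r : Finset S → Finset S → Prop)
    (hC : IsPartition C) (hr : IsPartialOrderOn C r) (s t : S)
    (π π' : A₁ → ℝ) (hπ : ProbDist π) (hπ' : ProbDist π')
    (h : ∀ b : A₂, ∃ π'' : A₂ → ℝ, ProbDist π'' ∧
      LiftRelP C r (distOn (stepD δ s π π'')) (distOn (stepD δ t π' (diracD b)))) :
    Smyth (LiftRelP C r) (stepSet δ s π) (stepSet δ t π') := by
  rintro Θ ⟨p, hp, rfl⟩
  choose q hq w hw0 hw1 hw2 hw3 using h
  have hp_eq : p = fun a => ∑ b, p b * diracD b a := by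
    classical
    funext a
    simp [diracD]
  have hq_nonneg : ∀ a, 0 ≤ ∑ b, p b * q b a := fun a =>
    Finset.sum_nonneg fun b _ => mul_nonneg (hp.1 b).1 ((hq b).1 a).1
  refine ⟨_, ⟨fun a => ∑ b, p b * q b a, ⟨fun a => ⟨hq_nonneg a, ?_⟩, ?_⟩, rfl⟩,
    fun P Q => ∑ b, p b * w b P Q, ?_, ?_, ?_, ?_⟩
  · calc ∑ b, p b * q b a ≤ ∑ b, p b :=
          Finset.sum_le_sum fun b _ => mul_le_of_le_one_right (hp.1 b).1 ((hq b).1 a).2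
      _ = 1 := hp.2
  · rw [Finset.sum_comm]
    simp only [← Finset.mul_sum, (hq _).2, mul_one]
    exact hp.2
  · exact fun P Q => Finset.sum_nonneg fun b _ => mul_nonneg (hp.1 b).1 (hw0 b P Q)
  · intro P hP
    rw [distOn_stepD_mix, Finset.sum_comm]
    refine Finset.sum_congr rfl fun b _ => ?_
    rw [← Finset.mul_sum, hw1 b P hP]
  · intro Q hQ
    rw [hp_eq, distOn_stepD_mix, ← hp_eq, Finset.sum_comm]
    refine Finset.sum_congr rfl fun b _ => ?_
    rw [← Finset.mul_sum, hw2 b Q hQ]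
  · intro P Q hPQ
    obtain ⟨b, _, hb⟩ := Finset.exists_lt_of_sum_lt (s := Finset.univ)
      (f := fun _ : A₂ => (0 : ℝ)) (g := fun b => p b * w b P Q) (by simpa using hPQ)
    exact hw3 b P Q (pos_of_mul_pos_right hb (hp.1 b).1)

end PAGame
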